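/- For every β ≥ 0, h ∈ ℝ, every sequence ω taking values in {−1,+1} and every N ≥ 1: Z^c_{N,β,h,ω} ≤ exp( F(h+β) · #{1 ≤ n ≤ N : ω_n = +1} + F(h−β) · #{1 ≤ n ≤ N : ω_n = −1} ). -/

import Mathlib

open Filter Topology

/-- The contact point `t_i = s_1 + ⋯ + s_i` associated to interarrival times
`s : Fin k → {0,…,N}`. -/
def contacts {k N : ℕ} (s : Fin k → Fin (N + 1)) (i : Fin k) : ℕ :=
  ∑ j ∈ Finset.univ.filter (fun j => j ≤ i), (s j : ℕ)

/-- The constrained homogeneous partition function `Z_{N,u}` (with `Z_{0,u} = 1`). -/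
noncomputable def Zhom (K : ℕ → ℝ) (u : ℝ) (N : ℕ) : ℝ :=
  if N = 0 then 1 else
    ∑ k ∈ Finset.Icc 1 N, ∑ s : Fin k → Fin (N + 1),
      if (∀ i, 1 ≤ (s i : ℕ)) ∧ (∑ i, (s i : ℕ)) = N then
        Real.exp ((k : ℝ) * u) * ∏ i, K (s i : ℕ)
      else 0

/-- The quenched partition function `Z_{N,β,h,ω}`. -/
noncomputable def Zq (K : ℕ → ℝ) (β h : ℝ) (ω : ℕ → ℝ) (N : ℕ) : ℝ :=
  ∑ k ∈ Finset.Icc 1 N, ∑ s : Fin k → Fin (N + 1),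
    if (∀ i, 1 ≤ (s i : ℕ)) ∧ (∑ i, (s i : ℕ)) = N then
      Real.exp (∑ i : Fin k, (β * ω (contacts s i) + h)) * ∏ i, K (s i : ℕ)
    else 0

/-- The set of sign-change positions `m ∈ {2,…,N+1}` of `ω` (i.e. `ω_m ≠ ω_{m-1}`):
the strip endpoints `L_1 < ⋯ < L_{B_N}` are exactly these positions minus one. -/
noncomputable def changeSet (ω : ℕ → ℝ) (N : ℕ) : Finset ℕ :=
  (Finset.Icc 2 (N + 1)).filter fun m => ω m ≠ ω (m - 1)

/-- `B_N`, the number of complete strips between `0` and `N`. -/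
noncomputable def BN (ω : ℕ → ℝ) (N : ℕ) : ℕ := (changeSet ω N).card

/-- The strip endpoints: `L_0 = 0` and, for `1 ≤ k ≤ B_N`, `L_k` is the `k`-th
sign-change position of `ω` minus one. -/
noncomputable def Lstrip (ω : ℕ → ℝ) (N : ℕ) (k : ℕ) : ℕ :=
  if k = 0 then 0 else ((changeSet ω N).sort (· ≤ ·)).getD (k - 1) 0 - 1

/-- The constrained partition function `Z^c_{N,β,h,ω}`: the sum is restricted to
contact sets containing each of the strip endpoints `L_1, …, L_{B_N}`. -/
noncomputable def Zc (K : ℕ → ℝ) (β h : ℝ) (ω : ℕ → ℝ) (N : ℕ) : ℝ :=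
  ∑ k ∈ Finset.Icc 1 N, ∑ s : Fin k → Fin (N + 1),
    if (∀ i, 1 ≤ (s i : ℕ)) ∧ (∑ i, (s i : ℕ)) = N ∧
        (∀ m ∈ changeSet ω N, ∃ i : Fin k, contacts s i = m - 1) then
      Real.exp (∑ i : Fin k, (β * ω (contacts s i) + h)) * ∏ i, K (s i : ℕ)
    else 0

/-- The probability, under the stationary `{-1,+1}`-valued Markov chain `P^{(N)}`
with flip probability `N^{-γ}`, of the trajectory `w` on `{0,…,N+1}`. -/
noncomputable def pathProb (γ : ℝ) (N : ℕ) (w : Fin (N + 2) → Bool) : ℝ :=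
  (1 / 2) * ∏ i : Fin (N + 1),
    if w i.castSucc = w i.succ then 1 - (N : ℝ) ^ (-γ) else (N : ℝ) ^ (-γ)

/-- The `±1`-valued sequence associated to a trajectory `w` on `{0,…,N+1}`
(extended constantly beyond `N+1`; the partition functions at size `N` only
depend on the first `N+2` values). -/
noncomputable def omegaOf (N : ℕ) (w : Fin (N + 2) → Bool) (n : ℕ) : ℝ :=
  if hn : n < N + 2 then (if w ⟨n, hn⟩ then 1 else -1)
  else (if w (Fin.last (N + 1)) then 1 else -1)

/-- The limiting free energy of model B:
`G(β,h) = 0` if `h ≤ -β`, `F(h+β)/2` if `-β < h < β`, and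
`(F(h+β) + F(h-β))/2` if `h ≥ β`. -/
noncomputable def Gfun (F : ℝ → ℝ) (β h : ℝ) : ℝ :=
  if h ≤ -β then 0 else if h < β then F (h + β) / 2 else (F (h + β) + F (h - β)) / 2


/-- Weight of `k`-step paths from `0` to `n` for the kernel `M`. -/
noncomputable def pathW (M : ℕ → ℕ → ℝ) : ℕ → ℕ → ℝ
  | 0, n => if n = 0 then 1 else 0
  | k + 1, n => ∑ x ∈ Finset.range n, pathW M k x * M x n

/-- Total weight of paths from `0` to `n`. -/
noncomputable def totW (M : ℕ → ℕ → ℝ) (n : ℕ) : ℝ :=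
  ∑ k ∈ Finset.range (n + 1), pathW M k n

lemma pathW_zero_of_lt (M : ℕ → ℕ → ℝ) : ∀ k n, n < k → pathW M k n = 0 := by
  intro k
  induction k with
  | zero => intro n h; omega
  | succ k ih =>
    intro n h
    rw [pathW]
    apply Finset.sum_eq_zero
    intro x hx
    rw [Finset.mem_range] at hx
    rw [ih x (by omega), zero_mul]

lemma totW_eq (M : ℕ → ℕ → ℝ) (n B : ℕ) (h : n < B) :
    ∑ k ∈ Finset.range B, pathW M k n = totW M n := by
  unfold totW
  symm
  apply Finset.sum_subset
  · intro x hx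
    simp only [Finset.mem_range] at hx ⊢
    omega
  · intro x _ hx
    simp only [Finset.mem_range] at hx
    exact pathW_zero_of_lt M x n (by omega)

lemma totW_zero (M : ℕ → ℕ → ℝ) : totW M 0 = 1 := by
  simp [totW, pathW]

lemma totW_rec (M : ℕ → ℕ → ℝ) (n : ℕ) (hn : 1 ≤ n) :
    totW M n = ∑ x ∈ Finset.range n, totW M x * M x n := by
  rw [totW, Finset.sum_range_succ']
  have h0 : pathW M 0 n = 0 := by
    rw [pathW, if_neg (by omega)]
  rw [h0, add_zero]
  simp only [pathW]
  rw [Finset.sum_comm]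
  apply Finset.sum_congr rfl
  intro x hx
  rw [← Finset.sum_mul, totW_eq M x n (Finset.mem_range.mp hx)]

lemma totW_nonneg (M : ℕ → ℕ → ℝ) (hM : ∀ a b, a < b → 0 ≤ M a b) (n : ℕ) :
    0 ≤ totW M n := by
  induction n using Nat.strong_induction_on with
  | _ n ih =>
    rcases Nat.eq_zero_or_pos n with rfl | hn
    · rw [totW_zero]; norm_num
    · rw [totW_rec M n hn]
      apply Finset.sum_nonneg
      intro x hx
      rw [Finset.mem_range] at hx
      exact mul_nonneg (ih x hx) (hM x n hx)

lemma totW_strip (M : ℕ → ℕ → ℝ) (f : ℕ → ℝ) (L n : ℕ) (hLn : L ≤ n)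
    (h1 : ∀ b, L < b → b ≤ n → ∀ a, L ≤ a → a < b → M a b = f (b - a))
    (h2 : ∀ b, L < b → b ≤ n → ∀ a, a < L → M a b = 0) :
    totW M n = totW M L * totW (fun a b => f (b - a)) (n - L) := by
  induction n using Nat.strong_induction_on with
  | _ n ih =>
    rcases Nat.eq_or_lt_of_le hLn with rfl | hlt
    · simp [totW_zero]
    · rw [totW_rec M n (by omega), totW_rec _ (n - L) (by omega), Finset.mul_sum]
      obtain ⟨d, rfl⟩ : ∃ d, n = L + d := ⟨n - L, by omega⟩
      rw [Finset.sum_range_add, Nat.add_sub_cancel_left]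
      have hz : ∑ x ∈ Finset.range L, totW M x * M x (L + d) = 0 := by
        apply Finset.sum_eq_zero
        intro x hx
        rw [h2 (L + d) hlt le_rfl x (Finset.mem_range.mp hx), mul_zero]
      rw [hz, zero_add]
      apply Finset.sum_congr rfl
      intro x hx
      rw [Finset.mem_range] at hx
      rw [ih (L + x) (by omega) (by omega) (fun b hb hb' => h1 b hb (by omega))
        (fun b hb hb' => h2 b hb (by omega)), h1 (L + d) hlt le_rfl (L + x) (by omega) (by omega),
        Nat.add_sub_cancel_left, mul_assoc]
      congr 3
      omega

lemma contacts_snoc_castSucc {k B : ℕ} (s : Fin k → Fin (B + 1)) (x : Fin (B + 1)) (i : Fin k) :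
    contacts (Fin.snoc (α := fun _ => Fin (B + 1)) s x : Fin (k + 1) → Fin (B + 1)) i.castSucc
      = contacts s i := by
  unfold contacts
  rw [Finset.sum_filter, Finset.sum_filter, Fin.sum_univ_castSucc]
  simp [Fin.snoc_castSucc, Fin.castSucc_le_castSucc_iff, Fin.last_le_iff]

lemma contacts_snoc_last {k B : ℕ} (s : Fin k → Fin (B + 1)) (x : Fin (B + 1)) :
    contacts (Fin.snoc (α := fun _ => Fin (B + 1)) s x : Fin (k + 1) → Fin (B + 1)) (Fin.last k)
      = (∑ i, (s i : ℕ)) + x := by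
  unfold contacts
  rw [Finset.sum_filter, Fin.sum_univ_castSucc]
  simp [Fin.snoc_castSucc, Fin.le_last]

lemma boxsum_eq (M : ℕ → ℕ → ℝ) (B : ℕ) : ∀ k n, n ≤ B →
    (∑ s : Fin k → Fin (B + 1),
      if (∀ i, 1 ≤ (s i : ℕ)) ∧ (∑ i, (s i : ℕ)) = n then
        ∏ i, M (contacts s i - (s i : ℕ)) (contacts s i) else 0) = pathW M k n := by
  intro k
  induction k with
  | zero =>
    intro n _
    simp [pathW, eq_comm]
  | succ k ih =>
    intro n hn
    rw [← (Fin.snocEquiv (fun _ => Fin (B + 1))).sum_comp, Fintype.sum_prod_type]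
    have key : ∀ x : Fin (B + 1),
        (∑ s : Fin k → Fin (B + 1),
          if (∀ i, 1 ≤ ((Fin.snocEquiv (fun _ => Fin (B + 1)) (x, s)) i : ℕ)) ∧
            (∑ i, ((Fin.snocEquiv (fun _ => Fin (B + 1)) (x, s)) i : ℕ)) = n then
            ∏ i, M (contacts (Fin.snocEquiv (fun _ => Fin (B + 1)) (x, s)) i -
                ((Fin.snocEquiv (fun _ => Fin (B + 1)) (x, s)) i : ℕ))
              (contacts (Fin.snocEquiv (fun _ => Fin (B + 1)) (x, s)) i) else 0)
        = if 1 ≤ (x : ℕ) ∧ (x : ℕ) ≤ n then pathW M k (n - x) * M (n - x) n else 0 := by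
      intro x
      have c1 : ∀ (s : Fin k → Fin (B + 1)) (i : Fin k),
          contacts (Fin.snocEquiv (fun _ => Fin (B + 1)) (x, s)) i.castSucc = contacts s i :=
        fun s i => contacts_snoc_castSucc s x i
      have c2 : ∀ (s : Fin k → Fin (B + 1)),
          contacts (Fin.snocEquiv (fun _ => Fin (B + 1)) (x, s)) (Fin.last k)
            = (∑ i, (s i : ℕ)) + x :=
        fun s => contacts_snoc_last s x
      simp only [Fin.forall_fin_succ', Fin.sum_univ_castSucc, Fin.prod_univ_castSucc, c1, c2]
      simp only [Fin.snocEquiv_apply, Fin.snoc_castSucc, Fin.snoc_last]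
      split_ifs with hx
      · rw [← ih (n - x) (by omega), Finset.sum_mul]
        apply Finset.sum_congr rfl
        intro s _
        by_cases hs : (∀ i, 1 ≤ (s i : ℕ)) ∧ (∑ i, (s i : ℕ)) = n - x
        · rw [if_pos hs, if_pos ⟨⟨hs.1, hx.1⟩, by omega⟩, hs.2]
          congr 2 <;> omega
        · rw [if_neg hs, if_neg (fun h => hs ⟨h.1.1, by omega⟩), zero_mul]
      · apply Finset.sum_eq_zero
        intro s _
        rw [if_neg]
        intro h
        exact hx ⟨h.1.2, by omega⟩
    rw [Finset.sum_congr rfl (fun x _ => key x)]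
    rw [Fin.sum_univ_eq_sum_range
      (fun x : ℕ => if 1 ≤ x ∧ x ≤ n then pathW M k (n - x) * M (n - x) n else 0) (B + 1),
      ← Finset.sum_filter, pathW]
    apply Finset.sum_bij' (fun x _ => n - x) (fun x _ => n - x)
    · intro x hx; simp only [Finset.mem_filter, Finset.mem_range] at hx ⊢; omega
    · intro x hx; simp only [Finset.mem_filter, Finset.mem_range] at hx ⊢; omega
    · intro x hx; simp only [Finset.mem_filter, Finset.mem_range] at hx; omega
    · intro x hx; simp only [Finset.mem_range] at hx; omega
    · intro x hx; rfl

lemma boxsum_total (M : ℕ → ℕ → ℝ) (N : ℕ) (hN : 1 ≤ N) :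
    (∑ k ∈ Finset.Icc 1 N, ∑ s : Fin k → Fin (N + 1),
      if (∀ i, 1 ≤ (s i : ℕ)) ∧ (∑ i, (s i : ℕ)) = N then
        ∏ i, M (contacts s i - (s i : ℕ)) (contacts s i) else 0) = totW M N := by
  rw [Finset.sum_congr rfl (fun k _ => boxsum_eq M N k N le_rfl), totW]
  apply Finset.sum_subset
  · intro x hx
    simp only [Finset.mem_range, Finset.mem_Icc] at hx ⊢
    omega
  · intro x hx hx'
    simp only [Finset.mem_range, Finset.mem_Icc] at hx hx'
    obtain rfl : x = 0 := by omega
    rw [pathW, if_neg (by omega)]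

lemma self_le_contacts {k N : ℕ} (s : Fin k → Fin (N + 1)) (i : Fin k) :
    (s i : ℕ) ≤ contacts s i := by
  unfold contacts
  exact Finset.single_le_sum (f := fun j => (s j : ℕ)) (fun _ _ => Nat.zero_le _) (by simp)

lemma contacts_mono {k N : ℕ} (s : Fin k → Fin (N + 1)) {i j : Fin k} (h : i ≤ j) :
    contacts s i ≤ contacts s j := by
  unfold contacts
  apply Finset.sum_le_sum_of_subset
  intro x hx
  simp only [Finset.mem_filter, Finset.mem_univ, true_and] at hx ⊢
  exact hx.trans h

lemma contacts_lt {k N : ℕ} (s : Fin k → Fin (N + 1)) {i j : Fin k} (h : i < j) :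
    contacts s i + s j ≤ contacts s j := by
  have hj : j ∉ Finset.univ.filter (fun l => l ≤ i) := by simp [h]
  unfold contacts
  rw [add_comm, ← Finset.sum_insert (f := fun l => (s l : ℕ)) hj]
  apply Finset.sum_le_sum_of_subset
  intro x hx
  simp only [Finset.mem_insert, Finset.mem_filter, Finset.mem_univ, true_and] at hx ⊢
  rcases hx with rfl | hx
  · exact le_rfl
  · exact hx.trans h.le

lemma contacts_le_sum {k N : ℕ} (s : Fin k → Fin (N + 1)) (i : Fin k) :
    contacts s i ≤ ∑ j, (s j : ℕ) := by
  unfold contacts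
  exact Finset.sum_le_sum_of_subset (Finset.filter_subset _ _)

lemma Zhom_eq (K : ℕ → ℝ) (u : ℝ) (n : ℕ) :
    Zhom K u n = totW (fun a b => Real.exp u * K (b - a)) n := by
  rcases Nat.eq_zero_or_pos n with rfl | hn
  · simp [Zhom, totW_zero]
  · rw [← boxsum_total _ n hn, Zhom, if_neg (by omega)]
    refine Finset.sum_congr rfl fun k _ => Finset.sum_congr rfl fun s _ => ?_
    split_ifs
    · have : ∀ i, contacts s i - (contacts s i - (s i : ℕ)) = s i := fun i => by
        have := self_le_contacts s i
        omega
      simp only [this, Finset.prod_mul_distrib, Finset.prod_const, Finset.card_univ,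
        Fintype.card_fin, Real.exp_nat_mul]
    · rfl

open Classical in
/-- Kernel of the constrained model. -/
noncomputable def stripM (K : ℕ → ℝ) (β h : ℝ) (ω : ℕ → ℝ) (a b : ℕ) : ℝ :=
  if ∃ m, a < m ∧ m < b ∧ ω (m + 1) ≠ ω m then 0 else Real.exp (β * ω b + h) * K (b - a)

lemma stripM_nonneg (K : ℕ → ℝ) (hK : ∀ n, 1 ≤ n → 0 < K n) (β h : ℝ) (ω : ℕ → ℝ) (a b : ℕ)
    (hab : a < b) : 0 ≤ stripM K β h ω a b := by
  unfold stripM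
  split_ifs
  · exact le_rfl
  · exact mul_nonneg (Real.exp_pos _).le (hK _ (by omega)).le

lemma Zc_le (K : ℕ → ℝ) (hK : ∀ n, 1 ≤ n → 0 < K n) (β h : ℝ) (ω : ℕ → ℝ) (N : ℕ)
    (hN : 1 ≤ N) : Zc K β h ω N ≤ totW (stripM K β h ω) N := by
  rw [← boxsum_total _ N hN, Zc]
  refine Finset.sum_le_sum fun k _ => Finset.sum_le_sum fun s _ => ?_
  by_cases hs : (∀ i, 1 ≤ (s i : ℕ)) ∧ (∑ i, (s i : ℕ)) = N
  · rw [if_pos hs]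
    split_ifs with hc
    · rw [Real.exp_sum, ← Finset.prod_mul_distrib]
      apply le_of_eq
      apply Finset.prod_congr rfl
      intro i _
      have h1 := self_le_contacts s i
      have h2 := contacts_le_sum s i
      unfold stripM
      rw [if_neg]
      · congr 2
        omega
      · rintro ⟨m, hm1, hm2, hm3⟩
        obtain ⟨j, hj⟩ := hc.2.2 (m + 1) (by
          simp only [changeSet, Finset.mem_filter, Finset.mem_Icc, Nat.add_sub_cancel]
          exact ⟨by omega, hm3⟩)
        rw [Nat.add_sub_cancel] at hj
        rcases lt_or_ge j i with hji | hji
        · have := contacts_lt s hji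
          omega
        · have := contacts_mono s hji
          omega
    · apply Finset.prod_nonneg
      intro i _
      apply stripM_nonneg K hK
      have h1 := self_le_contacts s i
      have := hs.1 i
      omega
  · rw [if_neg hs, if_neg (fun h => hs ⟨h.1, h.2.1⟩)]

lemma exists_strip (ω : ℕ → ℝ) (n : ℕ) (hn : 1 ≤ n) :
    ∃ L, L < n ∧ (L = 0 ∨ ω (L + 1) ≠ ω L) ∧ ∀ b, L < b → b ≤ n → ω b = ω n := by
  induction n with
  | zero => omega
  | succ n ih =>
    by_cases h : n = 0 ∨ ω (n + 1) ≠ ω n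
    · refine ⟨n, by omega, h, fun b hb hb' => ?_⟩
      rw [show b = n + 1 by omega]
    · push Not at h
      obtain ⟨L, h1, h2, h3⟩ := ih (by omega)
      refine ⟨L, by omega, h2, fun b hb hb' => ?_⟩
      rcases Nat.lt_or_ge n b with hb2 | hb2
      · rw [show b = n + 1 by omega]
      · rw [h3 b hb hb2, h.2]

lemma Zhom_le (K : ℕ → ℝ) (F : ℝ → ℝ)
    (hF : ∀ u : ℝ,
      IsLUB {r : ℝ | ∃ N : ℕ, 1 ≤ N ∧ r = Real.log (Zhom K u N) / N} (F u))
    (u : ℝ) (n : ℕ) (hn : 1 ≤ n) : Zhom K u n ≤ Real.exp (n * F u) := by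
  have h := (hF u).1 ⟨n, hn, rfl⟩
  have hn' : (0 : ℝ) < n := by exact_mod_cast hn
  rw [div_le_iff₀ hn'] at h
  refine (Real.le_exp_log _).trans (Real.exp_le_exp.mpr ?_)
  linarith

lemma totW_strip_le (K : ℕ → ℝ) (hK : ∀ n, 1 ≤ n → 0 < K n) (F : ℝ → ℝ)
    (hF : ∀ u : ℝ,
      IsLUB {r : ℝ | ∃ N : ℕ, 1 ≤ N ∧ r = Real.log (Zhom K u N) / N} (F u))
    (β h : ℝ) (ω : ℕ → ℝ) (n : ℕ) :
    totW (stripM K β h ω) n ≤ Real.exp (∑ j ∈ Finset.range n, F (β * ω (j + 1) + h)) := by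
  induction n using Nat.strong_induction_on with
  | _ n ih =>
    rcases Nat.eq_zero_or_pos n with rfl | hn
    · simp [totW_zero]
    · obtain ⟨L, hL, hL2, hL3⟩ := exists_strip ω n hn
      rw [totW_strip (stripM K β h ω) (fun d => Real.exp (β * ω n + h) * K d) L n hL.le ?_ ?_,
        ← Zhom_eq K (β * ω n + h) (n - L)]
      · have e : ∑ j ∈ Finset.range n, F (β * ω (j + 1) + h)
            = ∑ j ∈ Finset.range L, F (β * ω (j + 1) + h)
              + ((n - L : ℕ) : ℝ) * F (β * ω n + h) := by
          obtain ⟨d, rfl⟩ : ∃ d, n = L + d := ⟨n - L, by omega⟩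
          rw [Finset.sum_range_add, Nat.add_sub_cancel_left]
          congr 1
          rw [Finset.sum_congr rfl (g := fun _ => F (β * ω (L + d) + h))]
          · simp
          · intro x hx
            rw [Finset.mem_range] at hx
            rw [hL3 (L + x + 1) (by omega) (by omega)]
        rw [e, Real.exp_add]
        apply mul_le_mul (ih L hL) (Zhom_le K F hF _ _ (by omega)) _ (Real.exp_pos _).le
        rw [Zhom_eq]
        apply totW_nonneg
        intro a b hab
        exact mul_nonneg (Real.exp_pos _).le (hK _ (by omega)).le
      · intro b hb hb' a ha hab
        unfold stripM
        rw [if_neg, hL3 b hb hb']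
        rintro ⟨m, hm1, hm2, hm3⟩
        exact hm3 ((hL3 (m + 1) (by omega) (by omega)).trans (hL3 m (by omega) (by omega)).symm)
      · intro b hb hb' a ha
        unfold stripM
        rw [if_pos]
        exact ⟨L, ha, hb, hL2.resolve_left (by omega)⟩

/-- With `F(u) = sup_{N ≥ 1} (1/N) log Z_{N,u}`, for every
`β ≥ 0`, `h`, every `±1`-valued `ω` and every `N ≥ 1`,
`Z^c_{N,β,h,ω} ≤ exp(F(h+β) · #{1 ≤ n ≤ N : ω_n = +1} +
F(h-β) · #{1 ≤ n ≤ N : ω_n = -1})`. -/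
theorem statement14 (K : ℕ → ℝ) (hKpos : ∀ n, 1 ≤ n → 0 < K n)
    (hKsum : ∑' n : ℕ, K (n + 1) = 1)
    (F : ℝ → ℝ)
    (hF : ∀ u : ℝ,
      IsLUB {r : ℝ | ∃ N : ℕ, 1 ≤ N ∧ r = Real.log (Zhom K u N) / N} (F u))
    (β h : ℝ) (hβ : 0 ≤ β)
    (ω : ℕ → ℝ) (hω : ∀ n, ω n = 1 ∨ ω n = -1)
    (N : ℕ) (hN : 1 ≤ N) :
    Zc K β h ω N ≤
      Real.exp (F (h + β) * ((Finset.Icc 1 N).filter (fun n => ω n = 1)).card +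
        F (h - β) * ((Finset.Icc 1 N).filter (fun n => ω n = -1)).card) := by
  refine (Zc_le K hKpos β h ω N hN).trans ((totW_strip_le K hKpos F hF β h ω N).trans ?_)
  apply Real.exp_le_exp.mpr
  apply le_of_eq
  have e : ∀ n, F (β * ω n + h) =
      F (h + β) * (if ω n = 1 then 1 else 0) + F (h - β) * (if ω n = -1 then 1 else 0) := by
    intro n
    rcases hω n with hn | hn
    · rw [hn, if_pos rfl, if_neg (by norm_num)]
      rw [mul_one, mul_one, mul_zero, add_zero, add_comm]
    · rw [hn, if_neg (by norm_num), if_pos rfl]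
      rw [mul_one, mul_zero, zero_add, mul_neg_one, neg_add_eq_sub]
  rw [Finset.card_filter, Finset.card_filter]
  push_cast
  rw [Finset.mul_sum, Finset.mul_sum, ← Finset.sum_add_distrib,
    ← Finset.sum_congr rfl (fun n _ => e n), Finset.range_eq_Ico,
    Finset.sum_Ico_add' (fun n => F (β * ω n + h)) 0 N 1]
  rfl
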